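/- arXiv:2504.02493 — 4 statements merged into one kernel-verified Lean document; each statement's English description precedes it below -/
import Mathlib

section
/- For each j with 1 ≤ j ≤ 2n−1, the associate class V_{d_j} of the divisor d_j = (1+i)^{2n−j} in the ring R = ℤ[i]/(2^n) has exactly 2^{j−1} elements. -/
/-- The ring `ℤ[i]/(2^n)` of Gaussian integers modulo `2^n`. -/
abbrev Rmod (n : ℕ) : Type := GaussianInt ⧸ Ideal.span {(2 : GaussianInt) ^ n}

/-- The image in `ℤ[i]/(2^n)` of the divisor `d_j = (1+i)^(2n-j)` of `2^n`. -/
def dElt (n j : ℕ) : Rmod n :=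
  Ideal.Quotient.mk _ ((1 + ⟨0, 1⟩ : GaussianInt) ^ (2 * n - j))

/-- The associate class `V_{d_j} = {u • d_j : u a unit}` in `ℤ[i]/(2^n)`. -/
def Vclass (n j : ℕ) : Set (Rmod n) :=
  {x | ∃ u : (Rmod n)ˣ, x = (u : Rmod n) * dElt n j}

section ChainRing

variable {R : Type*} [CommRing R] {p : R} {N : ℕ}

theorem pow_notMem_span_pow_succ (hN : p ^ N = 0) (hN' : p ^ (N - 1) ≠ 0) {k : ℕ} (hk : k < N) :
    p ^ k ∉ Ideal.span {p ^ (k + 1)} := by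
  intro h
  obtain ⟨c, hc⟩ := Ideal.mem_span_singleton.1 h
  apply hN'
  calc p ^ (N - 1) = p ^ k * p ^ (N - 1 - k) := by rw [← pow_add]; congr 1; omega
    _ = p ^ (k + 1) * p ^ (N - 1 - k) * c := by rw [hc]; ring
    _ = p ^ N * c := by rw [← pow_add]; congr 2; omega
    _ = 0 := by rw [hN, zero_mul]

theorem dvd_sub_one_of_isUnit (hp : ∀ r : R, p ∣ r ∨ p ∣ r - 1) (hN : p ^ N = 0)
    (hN' : p ^ (N - 1) ≠ 0) {u : R} (hu : IsUnit u) : p ∣ u - 1 := by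
  refine (hp u).resolve_left fun h => hN' ?_
  have hz : IsUnit (p ^ N) := (isUnit_of_dvd_unit h hu).pow N
  rw [hN] at hz
  exact hz.mul_left_cancel (by simp)

/-- In a ring whose maximal ideal `(p)` is nilpotent with residue field of two elements, the
associates of `p ^ k` form the coset `p ^ k + (p ^ (k + 1))`. -/
theorem setOf_unit_mul_pow_eq_image (hp : ∀ r : R, p ∣ r ∨ p ∣ r - 1) (hN : p ^ N = 0)
    (hN' : p ^ (N - 1) ≠ 0) (k : ℕ) :
    {x | ∃ u : Rˣ, x = (u : R) * p ^ k} =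
      (p ^ k + ·) '' (Ideal.span {p ^ (k + 1)} : Set R) := by
  ext x
  simp only [Set.mem_ofPred_eq, Set.mem_image, SetLike.mem_coe, Ideal.mem_span_singleton]
  constructor
  · rintro ⟨u, rfl⟩
    obtain ⟨c, hc⟩ := dvd_sub_one_of_isUnit hp hN hN' u.isUnit
    exact ⟨p ^ (k + 1) * c, ⟨c, rfl⟩, by linear_combination (-p ^ k) * hc⟩
  · rintro ⟨_, ⟨c, rfl⟩, rfl⟩
    have hnil : IsNilpotent (p * c) := ⟨N, by rw [mul_pow, hN, zero_mul]⟩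
    obtain ⟨u, hu⟩ := hnil.isUnit_one_add
    exact ⟨u, by rw [hu]; ring⟩

theorem span_pow_eq_union_image (hp : ∀ r : R, p ∣ r ∨ p ∣ r - 1) (k : ℕ) :
    (Ideal.span {p ^ k} : Set R) = (Ideal.span {p ^ (k + 1)} : Set R) ∪
      (p ^ k + ·) '' (Ideal.span {p ^ (k + 1)} : Set R) := by
  ext x
  simp only [Set.mem_union, Set.mem_image, SetLike.mem_coe, Ideal.mem_span_singleton]
  constructor
  · rintro ⟨r, rfl⟩
    obtain ⟨c, hc⟩ | ⟨c, hc⟩ := hp r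
    · exact Or.inl ⟨c, by rw [hc]; ring⟩
    · exact Or.inr ⟨p ^ (k + 1) * c, ⟨c, rfl⟩, by linear_combination (-p ^ k) * hc⟩
  · rintro (⟨c, rfl⟩ | ⟨_, ⟨c, rfl⟩, rfl⟩)
    · exact ⟨p * c, by ring⟩
    · exact ⟨1 + p * c, by ring⟩

theorem ncard_span_pow_sub (hp : ∀ r : R, p ∣ r ∨ p ∣ r - 1) (hN : p ^ N = 0)
    (hN' : p ^ (N - 1) ≠ 0) {m : ℕ} (hm : m ≤ N) :
    (Ideal.span {p ^ (N - m)} : Set R).ncard = 2 ^ m := by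
  induction m with
  | zero => simp [hN]
  | succ m ih =>
    have ih := ih (by omega)
    obtain ⟨k, hk⟩ : ∃ k, k = N - (m + 1) := ⟨_, rfl⟩
    rw [show N - m = k + 1 by omega] at ih
    rw [← hk, span_pow_eq_union_image hp]
    have hfin : (Ideal.span {p ^ (k + 1)} : Set R).Finite :=
      Set.finite_of_ncard_ne_zero (by rw [ih]; positivity)
    rw [Set.ncard_union_eq _ hfin (hfin.image _),
      Set.ncard_image_of_injective _ (add_right_injective _), ih]
    · ring
    · rw [Set.disjoint_left]
      rintro _ hx ⟨y, hy, rfl⟩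
      exact pow_notMem_span_pow_succ hN hN' (by omega : k < N)
        ((Submodule.add_mem_iff_left _ hy).1 hx)

end ChainRing

namespace GaussianInt

theorem one_add_I_dvd_or_dvd_sub_one (z : GaussianInt) :
    (1 + ⟨0, 1⟩ : GaussianInt) ∣ z ∨ (1 + ⟨0, 1⟩ : GaussianInt) ∣ z - 1 := by
  obtain ⟨a, b⟩ := z
  obtain ⟨c, hc⟩ | ⟨c, hc⟩ := Int.even_or_odd (a + b)
  · exact Or.inl ⟨⟨c, c - a⟩, by ext <;> simp; omega⟩
  · exact Or.inr ⟨⟨c, c - a + 1⟩, by ext <;> (simp; omega)⟩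

theorem one_add_I_pow_two_mul (n : ℕ) :
    (1 + ⟨0, 1⟩ : GaussianInt) ^ (2 * n) = 2 ^ n * ⟨0, 1⟩ ^ n := by
  rw [pow_mul, ← mul_pow]
  congr 1

theorem not_two_pow_dvd_one_add_I_pow {n : ℕ} (hn : 1 ≤ n) :
    ¬ (2 : GaussianInt) ^ n ∣ (1 + ⟨0, 1⟩) ^ (2 * n - 1) := by
  intro h
  have h' := map_dvd Zsqrtd.normMonoidHom h
  rw [map_pow, map_pow] at h'
  have h2 : Zsqrtd.normMonoidHom (2 : GaussianInt) = 2 ^ 2 := by decide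
  have h1 : Zsqrtd.normMonoidHom (1 + ⟨0, 1⟩ : GaussianInt) = 2 := by decide
  rw [h2, h1, ← pow_mul] at h'
  have := (pow_dvd_pow_iff (by norm_num) (by decide)).1 h'
  omega

end GaussianInt

theorem stmt_0 (n : ℕ) (hn : 2 ≤ n) (j : ℕ) (hj1 : 1 ≤ j) (hj2 : j ≤ 2 * n - 1) :
    Nat.card ↥(Vclass n j) = 2 ^ (j - 1) := by
  set p : Rmod n := Ideal.Quotient.mk _ (1 + ⟨0, 1⟩ : GaussianInt) with hpdef
  have hp : ∀ r : Rmod n, p ∣ r ∨ p ∣ r - 1 := by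
    intro r
    obtain ⟨z, rfl⟩ := Ideal.Quotient.mk_surjective r
    rw [← map_one (Ideal.Quotient.mk _), ← map_sub]
    exact (GaussianInt.one_add_I_dvd_or_dvd_sub_one z).imp (map_dvd _) (map_dvd _)
  have hN : p ^ (2 * n) = 0 := by
    rw [hpdef, ← map_pow, Ideal.Quotient.eq_zero_iff_dvd, GaussianInt.one_add_I_pow_two_mul]
    exact dvd_mul_right _ _
  have hN' : p ^ (2 * n - 1) ≠ 0 := by
    rw [hpdef, ← map_pow, Ne, Ideal.Quotient.eq_zero_iff_dvd]
    exact GaussianInt.not_two_pow_dvd_one_add_I_pow (by omega)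
  have hV : Vclass n j = {x | ∃ u : (Rmod n)ˣ, x = (u : Rmod n) * p ^ (2 * n - j)} := by
    simp only [Vclass, dElt, hpdef, map_pow]
  rw [Nat.card_coe_set_eq, hV, setOf_unit_mul_pow_eq_image hp hN hN',
    Set.ncard_image_of_injective _ (add_right_injective _),
    show 2 * n - j + 1 = 2 * n - (j - 1) by omega]
  exact ncard_span_pow_sub hp hN hN' (by omega)
end

section
/- The number of elements x of R = ℤ[i]/(2^n) with x ≠ 0 and x² = 0 (nilpotent elements of index 2) is exactly 2^n − 1. -/
lemma associated_two_pow_one_add_I_pow_sq (n : ℕ) :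
    Associated ((2 : GaussianInt) ^ n) (((1 + ⟨0, 1⟩ : GaussianInt) ^ n) ^ 2) := by
  rw [← pow_mul, mul_comm n 2, pow_mul]
  refine Associated.pow_pow ⟨⟨⟨0, 1⟩, ⟨0, -1⟩, by decide, by decide⟩, ?_⟩
  decide

lemma two_pow_dvd_sq_iff (n : ℕ) (z : GaussianInt) :
    (2 : GaussianInt) ^ n ∣ z ^ 2 ↔ (1 + ⟨0, 1⟩ : GaussianInt) ^ n ∣ z := by
  rw [(associated_two_pow_one_add_I_pow_sq n).dvd_iff_dvd_left,
    IsIntegrallyClosed.pow_dvd_pow_iff two_ne_zero]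

lemma two_pow_dvd_one_add_I_pow_mul_iff (n : ℕ) (z : GaussianInt) :
    (2 : GaussianInt) ^ n ∣ (1 + ⟨0, 1⟩ : GaussianInt) ^ n * z ↔
      (1 + ⟨0, 1⟩ : GaussianInt) ^ n ∣ z := by
  have h : (1 + ⟨0, 1⟩ : GaussianInt) ≠ 0 := by decide
  rw [(associated_two_pow_one_add_I_pow_sq n).dvd_iff_dvd_left, sq,
    mul_dvd_mul_iff_left (pow_ne_zero n h)]

/-- Reduction of both coordinates of a Gaussian integer modulo `m`. -/
def GaussianInt.coordsMod (m : ℕ) : GaussianInt →+ ZMod m × ZMod m where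
  toFun z := (z.re, z.im)
  map_zero' := by simp
  map_add' x y := by simp

lemma GaussianInt.coordsMod_surjective (m : ℕ) :
    Function.Surjective (GaussianInt.coordsMod m) := by
  rintro ⟨a, b⟩
  obtain ⟨a, rfl⟩ := ZMod.intCast_surjective a
  obtain ⟨b, rfl⟩ := ZMod.intCast_surjective b
  exact ⟨⟨a, b⟩, rfl⟩

lemma GaussianInt.ker_coordsMod (m : ℕ) :
    (GaussianInt.coordsMod m).ker = (Ideal.span {(m : GaussianInt)}).toAddSubgroup := by
  ext z
  have h := Zsqrtd.intCast_dvd (d := -1) (m : ℤ) z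
  rw [Int.cast_natCast] at h
  simp [AddMonoidHom.mem_ker, GaussianInt.coordsMod, Ideal.mem_span_singleton, h,
    ZMod.intCast_zmod_eq_zero_iff_dvd]

lemma GaussianInt.natCard_quotient_span_natCast (m : ℕ) :
    Nat.card (GaussianInt ⧸ Ideal.span {(m : GaussianInt)}) = m ^ 2 := by
  have h := Nat.card_congr (QuotientAddGroup.quotientKerEquivOfSurjective _
    (GaussianInt.coordsMod_surjective m)).toEquiv
  rw [GaussianInt.ker_coordsMod, Nat.card_prod, Nat.card_zmod, ← sq] at h
  exact h

lemma Rmod.natCard (n : ℕ) : Nat.card (Rmod n) = (2 ^ n) ^ 2 := by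
  have h := GaussianInt.natCard_quotient_span_natCast (2 ^ n)
  rwa [Nat.cast_pow, Nat.cast_ofNat] at h

/-- Multiplication by `(1 + i)^n` on `ℤ[i]/(2^n)`. -/
def Rmod.mulOneAddIPow (n : ℕ) : Rmod n →+ Rmod n :=
  AddMonoidHom.mulLeft (Ideal.Quotient.mk _ ((1 + ⟨0, 1⟩ : GaussianInt) ^ n))

lemma Rmod.mem_ker_mulOneAddIPow {n : ℕ} {x : Rmod n} :
    x ∈ (Rmod.mulOneAddIPow n).ker ↔ x ^ 2 = 0 := by
  obtain ⟨z, rfl⟩ := Ideal.Quotient.mk_surjective x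
  rw [AddMonoidHom.mem_ker, Rmod.mulOneAddIPow, AddMonoidHom.coe_mulLeft, ← map_mul, ← map_pow,
    Ideal.Quotient.eq_zero_iff_dvd, Ideal.Quotient.eq_zero_iff_dvd,
    two_pow_dvd_one_add_I_pow_mul_iff, two_pow_dvd_sq_iff]

lemma Rmod.range_mulOneAddIPow (n : ℕ) :
    (Rmod.mulOneAddIPow n).range = (Rmod.mulOneAddIPow n).ker := by
  ext x
  rw [Rmod.mem_ker_mulOneAddIPow]
  constructor
  · rintro ⟨y, rfl⟩
    obtain ⟨z, rfl⟩ := Ideal.Quotient.mk_surjective y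
    rw [Rmod.mulOneAddIPow, AddMonoidHom.coe_mulLeft, ← map_mul, ← map_pow,
      Ideal.Quotient.eq_zero_iff_dvd, two_pow_dvd_sq_iff]
    exact dvd_mul_right _ _
  · obtain ⟨z, rfl⟩ := Ideal.Quotient.mk_surjective x
    rw [← map_pow, Ideal.Quotient.eq_zero_iff_dvd, two_pow_dvd_sq_iff]
    rintro ⟨w, rfl⟩
    exact ⟨Ideal.Quotient.mk _ w, (map_mul _ _ _).symm⟩

lemma Rmod.natCard_ker_mulOneAddIPow (n : ℕ) :
    Nat.card (Rmod.mulOneAddIPow n).ker = 2 ^ n := by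
  have h := (Rmod.mulOneAddIPow n).ker.card_mul_index
  rw [AddSubgroup.index_ker, Rmod.range_mulOneAddIPow, Rmod.natCard, ← sq] at h
  exact Nat.pow_left_injective two_ne_zero h

theorem stmt_2 (n : ℕ) (hn : 2 ≤ n) :
    Nat.card ↥{x : Rmod n | x ≠ 0 ∧ x ^ 2 = 0} = 2 ^ n - 1 := by
  have h : {x : Rmod n | x ≠ 0 ∧ x ^ 2 = 0} =
      ((Rmod.mulOneAddIPow n).ker : Set (Rmod n)) \ {0} := by
    ext x
    simp only [Set.mem_ofPred_eq, Set.mem_sdiff, SetLike.mem_coe, Rmod.mem_ker_mulOneAddIPow,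
      Set.mem_singleton_iff, and_comm, ne_eq]
  rw [h, Nat.card_coe_set_eq, Set.ncard_sdiff_singleton_of_mem (zero_mem _),
    ← Nat.card_coe_set_eq]
  exact congrArg (· - 1) (Rmod.natCard_ker_mulOneAddIPow n)
end

section
/- In the zero-divisor graph Γ(R) of R = ℤ[i]/(2^n), the subgraph induced by the associate class V_{d_j} is a complete graph when 1 ≤ j ≤ n, and is edgeless (the complement of a complete graph) when n+1 ≤ j ≤ 2n−1. -/
theorem one_add_I_sq : (1 + ⟨0, 1⟩ : GaussianInt) ^ 2 = 2 * ⟨0, 1⟩ := by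
  ext <;> simp [sq]

theorem two_pow_dvd_one_add_I_pow_iff (n k : ℕ) :
    (2 : GaussianInt) ^ n ∣ (1 + ⟨0, 1⟩ : GaussianInt) ^ k ↔ 2 * n ≤ k := by
  constructor
  · intro h
    have hnorm := map_dvd (Zsqrtd.normMonoidHom (d := -1)) h
    rw [map_pow, map_pow] at hnorm
    have h2 : Zsqrtd.normMonoidHom (2 : GaussianInt) = 2 ^ 2 := by
      decide
    have h1 : Zsqrtd.normMonoidHom (1 + ⟨0, 1⟩ : GaussianInt) = 2 := by
      decide
    rw [h2, h1, ← pow_mul] at hnorm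
    have hnat : 2 ^ (2 * n) ∣ 2 ^ k := by exact_mod_cast hnorm
    exact (Nat.pow_dvd_pow_iff_le_right (by norm_num)).mp hnat
  · intro h
    refine dvd_trans ?_ (pow_dvd_pow _ h)
    rw [pow_mul, one_add_I_sq, mul_pow]
    exact dvd_mul_right _ _

theorem dElt_mul_self_eq_zero_iff (n j : ℕ) :
    dElt n j * dElt n j = 0 ↔ 2 * n ≤ (2 * n - j) + (2 * n - j) := by
  rw [dElt, ← map_mul, ← pow_add, Ideal.Quotient.eq_zero_iff_mem, Ideal.mem_span_singleton,
    two_pow_dvd_one_add_I_pow_iff]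

theorem mul_eq_zero_iff_of_mem_Vclass {n j : ℕ} {x y : Rmod n} (hx : x ∈ Vclass n j)
    (hy : y ∈ Vclass n j) : x * y = 0 ↔ 2 * n ≤ (2 * n - j) + (2 * n - j) := by
  obtain ⟨u, rfl⟩ := hx
  obtain ⟨v, rfl⟩ := hy
  rw [mul_mul_mul_comm, ← Units.val_mul, Units.mul_right_eq_zero, dElt_mul_self_eq_zero_iff]

theorem stmt_5 (n : ℕ) (hn : 2 ≤ n) :
    (∀ j, 1 ≤ j → j ≤ n →
      ∀ x ∈ Vclass n j, ∀ y ∈ Vclass n j, x ≠ y → x * y = 0) ∧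
    (∀ j, n + 1 ≤ j → j ≤ 2 * n - 1 →
      ∀ x ∈ Vclass n j, ∀ y ∈ Vclass n j, x ≠ y → x * y ≠ 0) := by
  refine ⟨fun j _ hj x hx y hy _ => ?_, fun j hj hj' x hx y hy _ => ?_⟩
  · rw [mul_eq_zero_iff_of_mem_Vclass hx hy]
    omega
  · rw [Ne, mul_eq_zero_iff_of_mem_Vclass hx hy]
    omega
end

section
/- The union ⋃_{j=1}^{n} V_{d_j} of the associate classes of d_1, …, d_n forms a clique in the zero-divisor graph Γ(R) of R = ℤ[i]/(2^n): any two distinct elements of this union have product zero in R. -/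
theorem two_pow_dvd_one_add_I_pow {n m : ℕ} (h : 2 * n ≤ m) :
    (2 : GaussianInt) ^ n ∣ (1 + ⟨0, 1⟩ : GaussianInt) ^ m := by
  have hsq : (2 : GaussianInt) ∣ (1 + ⟨0, 1⟩ : GaussianInt) ^ 2 :=
    ⟨⟨0, 1⟩, by decide⟩
  refine (pow_dvd_pow_of_dvd hsq n).trans ?_
  rw [← pow_mul]
  exact pow_dvd_pow _ h

theorem dElt_mul_dElt_eq_zero {n j k : ℕ} (hj : j ≤ n) (hk : k ≤ n) :
    dElt n j * dElt n k = 0 := by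
  rw [dElt, dElt, ← map_mul, ← pow_add, Ideal.Quotient.eq_zero_iff_mem,
    Ideal.mem_span_singleton]
  exact two_pow_dvd_one_add_I_pow (by omega)

theorem stmt_7 (n : ℕ) (hn : 2 ≤ n) (x y : Rmod n)
    (hx : ∃ j, 1 ≤ j ∧ j ≤ n ∧ x ∈ Vclass n j)
    (hy : ∃ j, 1 ≤ j ∧ j ≤ n ∧ y ∈ Vclass n j)
    (hxy : x ≠ y) : x * y = 0 := by
  obtain ⟨j, -, hj, u, rfl⟩ := hx
  obtain ⟨k, -, hk, v, rfl⟩ := hy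
  rw [mul_mul_mul_comm, dElt_mul_dElt_eq_zero hj hk, mul_zero]
end
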